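/- For 0 < α < 1 and z ∈ ℝ, the Mittag-Leffler function satisfies E_α(z) = ∫₀^∞ Φ_α(t) e^{zt} dt, where Φ_α is the Wright function Φ_α(z) = Σ_{n≥0} (−z)ⁿ / (n! Γ(−αn + 1 − α)) and E_α(z) = Σ_{k≥0} z^k / Γ(αk + 1). -/

import Mathlib

open Real MeasureTheory

/-- The Wright function `Φ_α(z) = Σ_{n≥0} (−z)ⁿ / (n! Γ(−αn + 1 − α))`. -/
noncomputable def wrightFn (α z : ℝ) : ℝ :=
  ∑' n : ℕ, (-z) ^ n / (n.factorial * Real.Gamma (-α * n + 1 - α))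

/-- The Mittag-Leffler function `E_α(z) = Σ_{k≥0} z^k / Γ(αk + 1)`. -/
noncomputable def mittagLeffler (α z : ℝ) : ℝ :=
  ∑' k : ℕ, z ^ k / Real.Gamma (α * k + 1)

open Filter Topology Set

/-- The point `c + r (-1 + v i)` of the ray issuing from `c` in the direction `-1 + v i`. -/
noncomputable def ray (c v r : ℝ) : ℂ := c + r * (-1 + v * Complex.I)

/-- The integral of `e^ζ ζ^p` along the ray issuing from `c` in the direction `-1 + v i`. -/
noncomputable def rayIntegral (c v p : ℝ) : ℂ :=
  ∫ r in Ioi (0 : ℝ), Complex.exp (ray c v r) * ray c v r ^ (p : ℂ) * (-1 + v * Complex.I)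

lemma ray_re (c v r : ℝ) : (ray c v r).re = c - r := by simp [ray, sub_eq_add_neg]

lemma ray_im (c v r : ℝ) : (ray c v r).im = r * v := by simp [ray]

@[fun_prop]
lemma continuous_ray (c v : ℝ) : Continuous (ray c v) := by unfold ray; fun_prop

@[fun_prop]
lemma measurable_ray (c v : ℝ) : Measurable (ray c v) := (continuous_ray c v).measurable

lemma ray_mem_slitPlane {c v r : ℝ} (hc : 0 < c) (hv : 0 < v) (hr : 0 ≤ r) :
    ray c v r ∈ Complex.slitPlane := by
  rw [Complex.mem_slitPlane_iff, ray_re, ray_im]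
  rcases hr.eq_or_lt with rfl | hr
  · left; simpa
  · right; positivity

lemma ray_ne_zero {c v r : ℝ} (hc : 0 < c) (hv : 0 < v) (hr : 0 ≤ r) : ray c v r ≠ 0 :=
  Complex.slitPlane_ne_zero (ray_mem_slitPlane hc hv hr)

lemma norm_ray_le {c v r : ℝ} (hc : 0 ≤ c) (hv : 0 ≤ v) (hr : 0 ≤ r) :
    ‖ray c v r‖ ≤ (1 + c + v) * (1 + r) := by
  have h := Complex.norm_le_abs_re_add_abs_im (ray c v r)
  rw [ray_re, ray_im, abs_of_nonneg (by positivity : 0 ≤ r * v)] at h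
  have h' : |c - r| ≤ c + r := by rw [abs_le]; constructor <;> linarith
  nlinarith [mul_nonneg hc hr]

lemma le_norm_ray {c v r : ℝ} (hc : 0 ≤ c) (hv : 0 ≤ v) :
    c * min 1 v / 2 ≤ ‖ray c v r‖ := by
  rcases le_total r (c / 2) with h | h
  · have h1 := Complex.abs_re_le_norm (ray c v r)
    rw [ray_re] at h1
    have h2 := le_abs_self (c - r)
    nlinarith [mul_le_mul_of_nonneg_left (min_le_left 1 v) hc]
  · have h1 := Complex.abs_im_le_norm (ray c v r)
    rw [ray_im] at h1
    have h2 := le_abs_self (r * v)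
    nlinarith [mul_le_mul_of_nonneg_left (min_le_right 1 v) hc]

lemma norm_exp_ray (c v r : ℝ) : ‖Complex.exp (ray c v r)‖ = Real.exp (c - r) := by
  rw [Complex.norm_exp, ray_re]

lemma rpow_le_mul_pow {x y p : ℝ} {N : ℕ} (hx : 0 < x) (hy : 1 ≤ y) (hxy : x ≤ y)
    (hyx : y⁻¹ ≤ x) (hp : |p| ≤ N) : x ^ p ≤ y ^ N := by
  have hy0 : 0 < y := by linarith
  have key : x ^ p ≤ y ^ |p| := by
    rcases le_total 0 p with h | h
    · rw [abs_of_nonneg h]; exact Real.rpow_le_rpow hx.le hxy h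
    · rw [abs_of_nonpos h, ← inv_inv y, Real.inv_rpow (by positivity), ← Real.rpow_neg (by positivity),
        neg_neg]
      exact Real.rpow_le_rpow_of_nonpos (by positivity) hyx h
  exact key.trans ((Real.rpow_le_rpow_of_exponent_le hy hp).trans_eq (Real.rpow_natCast y N))

lemma mul_one_add_pow_mul_exp_neg_le {K : ℝ} (hK : 0 ≤ K) (N : ℕ) {r : ℝ} (hr : 0 ≤ r) :
    (K * (1 + r)) ^ N * Real.exp (-r) ≤
      (2 * K) ^ N * N.factorial * Real.exp (1 / 2) * Real.exp (-r / 2) := by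
  have h := Real.pow_div_factorial_le_exp (x := (1 + r) / 2) (by positivity) N
  rw [div_le_iff₀ (by positivity)] at h
  have e : Real.exp ((1 + r) / 2) * Real.exp (-r) = Real.exp (1 / 2) * Real.exp (-r / 2) := by
    rw [← Real.exp_add, ← Real.exp_add]; ring_nf
  calc (K * (1 + r)) ^ N * Real.exp (-r)
      = (2 * K) ^ N * (((1 + r) / 2) ^ N * Real.exp (-r)) := by
        rw [← mul_assoc, ← mul_pow]; ring_nf
    _ ≤ (2 * K) ^ N * (Real.exp ((1 + r) / 2) * N.factorial * Real.exp (-r)) := by gcongr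
    _ = _ := by rw [mul_right_comm (Real.exp ((1 + r) / 2)), e]; ring

lemma exists_norm_exp_mul_cpow_ray_le {c v : ℝ} (hc : 0 < c) (hv : 0 < v) (N : ℕ) :
    ∃ C, 0 ≤ C ∧ ∀ p : ℝ, |p| ≤ N → ∀ r : ℝ, 0 ≤ r →
      ‖Complex.exp (ray c v r) * ray c v r ^ (p : ℂ)‖ ≤ C * Real.exp (-r / 2) := by
  set m := c * min 1 v / 2 with hm
  have hm0 : 0 < m := by have : 0 < min 1 v := lt_min one_pos hv; positivity
  set K := 1 + c + v + m⁻¹ with hK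
  have hK0 : 1 ≤ K := by have : 0 < m⁻¹ := by positivity
                         linarith
  refine ⟨Real.exp c * ((2 * K) ^ N * N.factorial * Real.exp (1 / 2)), by positivity, ?_⟩
  intro p hp r hr
  rw [norm_mul, norm_exp_ray, Complex.norm_cpow_real]
  have hmr := le_norm_ray (r := r) hc.le hv.le
  have hminv : 0 < m⁻¹ := by positivity
  have h1 : ‖ray c v r‖ ^ p ≤ (K * (1 + r)) ^ N := by
    refine rpow_le_mul_pow (hm0.trans_le hmr) (by nlinarith) ?_ ?_ hp
    · refine (norm_ray_le hc.le hv.le hr).trans ?_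
      gcongr; linarith
    · refine le_trans ?_ hmr
      rw [inv_le_comm₀ (by positivity) hm0]
      nlinarith
  calc Real.exp (c - r) * ‖ray c v r‖ ^ p
      ≤ Real.exp (c - r) * (K * (1 + r)) ^ N := by gcongr
    _ = Real.exp c * ((K * (1 + r)) ^ N * Real.exp (-r)) := by
        rw [sub_eq_add_neg, Real.exp_add]; ring
    _ ≤ Real.exp c * ((2 * K) ^ N * N.factorial * Real.exp (1 / 2) * Real.exp (-r / 2)) :=
        mul_le_mul_of_nonneg_left (mul_one_add_pow_mul_exp_neg_le (by linarith) N hr)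
          (Real.exp_nonneg _)
    _ = _ := by ring

lemma integrableOn_exp_neg_div_two :
    IntegrableOn (fun r : ℝ ↦ Real.exp (-r / 2)) (Ioi 0) := by
  refine (integrableOn_exp_mul_Ioi (a := -1 / 2) (by norm_num) 0).congr_fun (fun r _ ↦ ?_)
    measurableSet_Ioi
  simp only; ring_nf

lemma tendsto_mul_exp_neg_div_two (C : ℝ) :
    Tendsto (fun r : ℝ ↦ C * Real.exp (-r / 2)) atTop (𝓝 0) := by
  have : Tendsto (fun r : ℝ ↦ Real.exp (-r / 2)) atTop (𝓝 0) :=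
    Real.tendsto_exp_atBot.comp (tendsto_neg_atTop_atBot.atBot_div_const two_pos)
  simpa using this.const_mul C

lemma integrableOn_exp_mul_cpow_ray {c v : ℝ} (hc : 0 < c) (hv : 0 < v) (p : ℝ) :
    IntegrableOn (fun r ↦ Complex.exp (ray c v r) * ray c v r ^ (p : ℂ)) (Ioi 0) := by
  obtain ⟨N, hN⟩ := exists_nat_ge |p|
  obtain ⟨C, -, hC⟩ := exists_norm_exp_mul_cpow_ray_le hc hv N
  refine Integrable.mono' (integrableOn_exp_neg_div_two.const_mul C)
    (Measurable.aestronglyMeasurable (by fun_prop)) ?_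
  filter_upwards [ae_restrict_mem measurableSet_Ioi] with r hr
  exact hC p hN r (le_of_lt hr)

lemma continuous_rayIntegral {c v : ℝ} (hc : 0 < c) (hv : 0 < v) :
    Continuous (rayIntegral c v) := by
  rw [continuous_iff_continuousAt]
  intro p₀
  obtain ⟨N, hN⟩ := exists_nat_ge (|p₀| + 1)
  obtain ⟨C, -, hC⟩ := exists_norm_exp_mul_cpow_ray_le hc hv N
  refine tendsto_integral_filter_of_dominated_convergence
    (fun r ↦ C * Real.exp (-r / 2) * ‖(-1 + v * Complex.I : ℂ)‖)
    (.of_forall fun p ↦ Measurable.aestronglyMeasurable (by fun_prop)) ?_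
    ((integrableOn_exp_neg_div_two.const_mul C).mul_const _) ?_
  · filter_upwards [Metric.ball_mem_nhds p₀ one_pos] with p hp
    filter_upwards [ae_restrict_mem measurableSet_Ioi] with r hr
    rw [norm_mul]
    gcongr
    refine hC p ?_ r (le_of_lt hr)
    rw [Metric.mem_ball, Real.dist_eq] at hp
    have := abs_sub_abs_le_abs_sub p p₀
    linarith
  · filter_upwards [ae_restrict_mem measurableSet_Ioi] with r hr
    have h0 := ray_ne_zero hc hv (le_of_lt hr)
    have : Continuous fun p : ℝ ↦ ray c v r ^ (p : ℂ) :=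
      Complex.continuous_ofReal.const_cpow (Or.inl h0)
    exact ((this.const_mul _).mul_const _).tendsto p₀

lemma hasDerivAt_exp_mul_cpow {ζ : ℂ} (p : ℂ) (hζ : ζ ∈ Complex.slitPlane) :
    HasDerivAt (fun ζ ↦ Complex.exp ζ * ζ ^ p)
      (Complex.exp ζ * ζ ^ p + p * (Complex.exp ζ * ζ ^ (p - 1))) ζ := by
  refine ((Complex.hasDerivAt_exp ζ).mul ((hasDerivAt_id ζ).cpow_const hζ)).congr_deriv ?_
  simp only [id, mul_one]; ring

lemma hasDerivAt_ray (c v r : ℝ) : HasDerivAt (ray c v) (-1 + v * Complex.I) r := by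
  unfold ray
  simpa using ((Complex.ofRealCLM.hasDerivAt (x := r)).mul_const (-1 + v * Complex.I)).const_add
    (c : ℂ)

lemma im_exp_mul_cpow_ofReal {c : ℝ} (hc : 0 ≤ c) (p : ℝ) :
    (Complex.exp c * (c : ℂ) ^ (p : ℂ)).im = 0 := by
  rw [← Complex.ofReal_exp, ← Complex.ofReal_cpow hc, ← Complex.ofReal_mul, Complex.ofReal_im]

lemma rayIntegral_im_eq {c v : ℝ} (hc : 0 < c) (hv : 0 < v) (p : ℝ) :
    (rayIntegral c v p).im = -p * (rayIntegral c v (p - 1)).im := by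
  obtain ⟨N, hN⟩ := exists_nat_ge |p|
  obtain ⟨C, -, hC⟩ := exists_norm_exp_mul_cpow_ray_le hc hv N
  have hi (q : ℝ) := (integrableOn_exp_mul_cpow_ray hc hv q).mul_const (-1 + v * Complex.I)
  have key := integral_Ioi_of_hasDerivAt_of_tendsto' (a := 0) (m := 0)
    (f := fun r ↦ Complex.exp (ray c v r) * ray c v r ^ (p : ℂ))
    (f' := fun r ↦ Complex.exp (ray c v r) * ray c v r ^ (p : ℂ) * (-1 + v * Complex.I) +
      p * (Complex.exp (ray c v r) * ray c v r ^ ((p - 1 : ℝ) : ℂ) * (-1 + v * Complex.I)))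
    (fun r hr ↦ ?_) ((hi p).add ((hi (p - 1)).const_mul p)) ?_
  · rw [integral_add (hi p) ((hi (p - 1)).const_mul p), integral_const_mul] at key
    change rayIntegral c v p + p * rayIntegral c v (p - 1) = _ at key
    have := congrArg Complex.im key
    have h0 : ray c v 0 = c := by simp [ray]
    rw [h0, zero_sub, Complex.neg_im, im_exp_mul_cpow_ofReal hc.le, Complex.add_im,
      Complex.im_ofReal_mul] at this
    linarith
  · refine ((hasDerivAt_exp_mul_cpow p (ray_mem_slitPlane hc hv hr)).comp r
      (hasDerivAt_ray c v r)).congr_deriv ?_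
    push_cast; ring
  · refine squeeze_zero_norm' ?_ (tendsto_mul_exp_neg_div_two C)
    filter_upwards [eventually_ge_atTop 0] with r hr using hC p hN r hr

lemma hasDerivAt_ray_mul (c v r τ : ℝ) :
    HasDerivAt (fun τ : ℝ ↦ ray (τ * c) (τ * v) r) (c + r * (v * Complex.I)) τ := by
  have h : (fun τ : ℝ ↦ ray (τ * c) (τ * v) r) =
      fun τ : ℝ ↦ -(r : ℂ) + τ * (c + r * (v * Complex.I)) := by
    ext τ; simp only [ray]; push_cast; ring
  rw [h]
  simpa using ((Complex.ofRealCLM.hasDerivAt (x := τ)).mul_const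
    (c + r * (v * Complex.I) : ℂ)).const_add (-(r : ℂ))

lemma norm_exp_mul_cpow_ray_mul_le {c v K τ q r : ℝ} {N : ℕ} (hc : 0 ≤ c) (hv : 0 ≤ v)
    (hτ0 : 0 ≤ τ) (hτ : τ * (c + v) + 1 ≤ K) (hq : 0 ≤ q) (hqN : q ≤ N) (hr : 0 ≤ r) :
    ‖Complex.exp (ray (τ * c) (τ * v) r) * ray (τ * c) (τ * v) r ^ (q : ℂ)‖ ≤
      Real.exp K * ((K * (1 + r)) ^ N * Real.exp (-r)) := by
  rw [norm_mul, norm_exp_ray, Complex.norm_cpow_real]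
  have hτc : 0 ≤ τ * c := by positivity
  have hτv : 0 ≤ τ * v := by positivity
  have hK : 1 ≤ K := by nlinarith
  have h1 : ‖ray (τ * c) (τ * v) r‖ ≤ K * (1 + r) := by
    refine (norm_ray_le hτc hτv hr).trans ?_
    gcongr; linarith
  have h2 : ‖ray (τ * c) (τ * v) r‖ ^ q ≤ (K * (1 + r)) ^ N :=
    (Real.rpow_le_rpow (norm_nonneg _) h1 hq).trans
      ((Real.rpow_le_rpow_of_exponent_le (by nlinarith) hqN).trans_eq (Real.rpow_natCast _ N))
  calc _ ≤ Real.exp (K - r) * (K * (1 + r)) ^ N := by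
        gcongr; linarith
    _ = _ := by rw [sub_eq_add_neg, Real.exp_add]; ring

lemma integrableOn_mul_pow_mul_exp_neg (K : ℝ) (N : ℕ) :
    IntegrableOn (fun r : ℝ ↦ (K * (1 + r)) ^ N * Real.exp (-r)) (Ioi 0) := by
  refine Integrable.mono' (integrableOn_exp_neg_div_two.const_mul
    ((2 * |K|) ^ N * N.factorial * Real.exp (1 / 2)))
    (Measurable.aestronglyMeasurable (by fun_prop)) ?_
  filter_upwards [ae_restrict_mem measurableSet_Ioi] with r hr
  have hr' : 0 ≤ r := le_of_lt hr
  refine le_trans (le_of_eq ?_) (mul_one_add_pow_mul_exp_neg_le (abs_nonneg K) N hr')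
  rw [norm_mul, norm_pow, norm_mul, Real.norm_eq_abs, Real.norm_eq_abs, Real.norm_eq_abs,
    Real.abs_exp, abs_of_nonneg (by positivity : 0 ≤ 1 + r)]

/-- The derivative of the integrand of `rayIntegral (τ * c) (τ * v) p` with respect to `τ`. -/
noncomputable def rayIntegrandDeriv (c v p τ r : ℝ) : ℂ :=
  (Complex.exp (ray (τ * c) (τ * v) r) * ray (τ * c) (τ * v) r ^ (p : ℂ) +
    p * (Complex.exp (ray (τ * c) (τ * v) r) * ray (τ * c) (τ * v) r ^ ((p - 1 : ℝ) : ℂ))) *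
      ((c + r * (v * Complex.I)) * (-1 + (τ * v : ℝ) * Complex.I)) +
    Complex.exp (ray (τ * c) (τ * v) r) * ray (τ * c) (τ * v) r ^ (p : ℂ) * (v * Complex.I)

lemma norm_rayIntegrandDeriv_le {c v K p τ r : ℝ} {N : ℕ} (hc : 0 ≤ c) (hv : 0 ≤ v)
    (hτ0 : 0 ≤ τ) (hτ : τ * (c + v) + 1 ≤ K) (hK : c + v ≤ K) (hp : 1 ≤ p) (hpN : p ≤ N)
    (hr : 0 ≤ r) :
    ‖rayIntegrandDeriv c v p τ r‖ ≤
      (2 + p) * Real.exp K * ((K * (1 + r)) ^ (N + 2) * Real.exp (-r)) := by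
  have b1 := norm_exp_mul_cpow_ray_mul_le hc hv hτ0 hτ (by linarith) hpN hr
  have b2 := norm_exp_mul_cpow_ray_mul_le hc hv hτ0 hτ (q := p - 1) (by linarith)
    (by linarith : p - 1 ≤ N) hr
  set B := Real.exp K * ((K * (1 + r)) ^ N * Real.exp (-r)) with hB
  have hτc : 0 ≤ τ * c := by positivity
  have hτv : 0 ≤ τ * v := by positivity
  have hK1 : 1 ≤ K := by nlinarith
  set X := K * (1 + r) with hX
  have hX1 : 1 ≤ X := by nlinarith
  have hXK : K ≤ X := by nlinarith
  have hB0 : 0 ≤ B := by positivity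
  have n1 : ‖(c + r * (v * Complex.I) : ℂ)‖ ≤ X := by
    refine (norm_add_le _ _).trans ?_
    simp only [norm_mul, Complex.norm_real, Complex.norm_I, Real.norm_eq_abs, abs_of_nonneg hc,
      abs_of_nonneg hv, abs_of_nonneg hr, mul_one]
    nlinarith
  have n2 : ‖(-1 + (τ * v : ℝ) * Complex.I : ℂ)‖ ≤ X := by
    refine (norm_add_le _ _).trans ?_
    simp only [norm_mul, norm_neg, norm_one, Complex.norm_real, Complex.norm_I, Real.norm_eq_abs,
      abs_of_nonneg hτ0, abs_of_nonneg hv, mul_one]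
    nlinarith
  have n3 : ‖(v * Complex.I : ℂ)‖ ≤ X := by
    simp only [norm_mul, Complex.norm_real, Complex.norm_I, Real.norm_eq_abs, abs_of_nonneg hv,
      mul_one]
    linarith
  have n4 : ‖(p : ℂ)‖ = p := by
    rw [Complex.norm_real, Real.norm_eq_abs, abs_of_nonneg (by linarith)]
  have hp0 : 0 ≤ p := by linarith
  unfold rayIntegrandDeriv
  calc _ ≤ (B + p * B) * (X * X) + B * X := by
        refine (norm_add_le _ _).trans (add_le_add ?_ ?_)
        · rw [norm_mul, norm_mul (_ + _)]
          gcongr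
          refine (norm_add_le _ _).trans (add_le_add b1 ?_)
          rw [norm_mul, n4]
          gcongr
        · rw [norm_mul]; gcongr
    _ ≤ (B + p * B) * (X * X) + B * (X * X) := by
        gcongr; nlinarith
    _ = _ := by rw [hB]; ring

lemma hasDerivAt_rayIntegrand {c v : ℝ} (hc : 0 < c) (hv : 0 < v) (p : ℝ) {τ r : ℝ} (hτ : 0 < τ)
    (hr : 0 ≤ r) :
    HasDerivAt (fun τ : ℝ ↦ Complex.exp (ray (τ * c) (τ * v) r) *
      ray (τ * c) (τ * v) r ^ (p : ℂ) * (-1 + (τ * v : ℝ) * Complex.I))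
      (rayIntegrandDeriv c v p τ r) τ := by
  have h1 := (hasDerivAt_exp_mul_cpow p (ray_mem_slitPlane (mul_pos hτ hc) (mul_pos hτ hv) hr)).comp
    τ (hasDerivAt_ray_mul c v r τ)
  have h2 : HasDerivAt (fun τ : ℝ ↦ (-1 + (τ * v : ℝ) * Complex.I : ℂ)) (v * Complex.I) τ := by
    have := ((Complex.ofRealCLM.hasDerivAt (x := τ)).mul_const (v * Complex.I : ℂ)).const_add (-1)
    simpa [mul_assoc] using this
  refine (h1.mul h2).congr_deriv ?_
  simp only [rayIntegrandDeriv, Function.comp]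
  push_cast; ring

lemma integrableOn_rayIntegrandDeriv {c v p τ : ℝ} (hc : 0 ≤ c) (hv : 0 ≤ v) (hτ : 0 ≤ τ)
    (hp : 1 ≤ p) : IntegrableOn (rayIntegrandDeriv c v p τ) (Ioi 0) := by
  obtain ⟨N, hN⟩ := exists_nat_ge p
  refine Integrable.mono' ((integrableOn_mul_pow_mul_exp_neg
    ((τ + 1) * (c + v) + 1) (N + 2)).const_mul
      ((2 + p) * Real.exp ((τ + 1) * (c + v) + 1)))
    (Measurable.aestronglyMeasurable (by unfold rayIntegrandDeriv; fun_prop)) ?_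
  filter_upwards [ae_restrict_mem measurableSet_Ioi] with r hr
  exact norm_rayIntegrandDeriv_le hc hv hτ (by nlinarith) (by nlinarith) hp hN (le_of_lt hr)

lemma integral_rayIntegrandDeriv_im {c v p τ : ℝ} (hc : 0 < c) (hv : 0 < v) (hτ : 0 < τ)
    (hp : 1 ≤ p) : (∫ r in Ioi 0, rayIntegrandDeriv c v p τ r).im = 0 := by
  obtain ⟨N, hN⟩ := exists_nat_ge p
  have key := integral_Ioi_of_hasDerivAt_of_tendsto' (a := 0) (m := 0)
    (f := fun r : ℝ ↦ Complex.exp (ray (τ * c) (τ * v) r) * ray (τ * c) (τ * v) r ^ (p : ℂ) *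
      (c + r * (v * Complex.I))) (f' := rayIntegrandDeriv c v p τ)
    (fun r hr ↦ ?_) (integrableOn_rayIntegrandDeriv hc.le hv.le hτ.le hp) ?_
  · have h0 : ray (τ * c) (τ * v) 0 = (τ * c : ℝ) := by simp [ray]
    rw [key, h0, zero_sub, Complex.neg_im, Complex.ofReal_zero, zero_mul, add_zero,
      Complex.im_mul_ofReal, im_exp_mul_cpow_ofReal (by positivity), zero_mul, neg_zero]
  · have h1 := (hasDerivAt_exp_mul_cpow p
      (ray_mem_slitPlane (mul_pos hτ hc) (mul_pos hτ hv) hr)).comp r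
      (hasDerivAt_ray (τ * c) (τ * v) r)
    have h2 : HasDerivAt (fun r : ℝ ↦ (c + r * (v * Complex.I) : ℂ)) (v * Complex.I) r := by
      simpa using ((Complex.ofRealCLM.hasDerivAt (x := r)).mul_const
        (v * Complex.I : ℂ)).const_add (c : ℂ)
    refine (h1.mul h2).congr_deriv ?_
    simp only [rayIntegrandDeriv, Function.comp]
    push_cast; ring
  · set K := τ * (c + v) + 1 + (c + v) with hK
    have hK0 : 0 ≤ K := by positivity
    refine squeeze_zero_norm' ?_ (tendsto_mul_exp_neg_div_two
      (Real.exp K * ((2 * K) ^ (N + 1) * (N + 1).factorial * Real.exp (1 / 2))))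
    filter_upwards [eventually_ge_atTop 0] with r hr
    have b := norm_exp_mul_cpow_ray_mul_le hc.le hv.le hτ.le (K := K) (by linarith)
      (by linarith : 0 ≤ p) hN hr
    have n1 : ‖(c + r * (v * Complex.I) : ℂ)‖ ≤ K * (1 + r) := by
      refine (norm_add_le _ _).trans ?_
      simp only [norm_mul, Complex.norm_real, Complex.norm_I, Real.norm_eq_abs, abs_of_pos hc,
        abs_of_pos hv, abs_of_nonneg hr, mul_one]
      have : 0 ≤ τ * (c + v) := by positivity
      nlinarith
    rw [norm_mul]
    calc _ ≤ Real.exp K * ((K * (1 + r)) ^ N * Real.exp (-r)) * (K * (1 + r)) := by gcongr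
      _ = Real.exp K * ((K * (1 + r)) ^ (N + 1) * Real.exp (-r)) := by ring
      _ ≤ Real.exp K * ((2 * K) ^ (N + 1) * (N + 1).factorial * Real.exp (1 / 2) *
            Real.exp (-r / 2)) :=
          mul_le_mul_of_nonneg_left (mul_one_add_pow_mul_exp_neg_le hK0 _ hr) (Real.exp_nonneg _)
      _ = _ := by ring

lemma hasDerivAt_rayIntegral_mul {c v p τ : ℝ} (hc : 0 < c) (hv : 0 < v) (hτ : 0 < τ)
    (hp : 1 ≤ p) :
    HasDerivAt (fun τ : ℝ ↦ rayIntegral (τ * c) (τ * v) p)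
      (∫ r in Ioi 0, rayIntegrandDeriv c v p τ r) τ := by
  obtain ⟨N, hN⟩ := exists_nat_ge p
  set K := (τ + 1) * (c + v) + 1 with hK
  refine (hasDerivAt_integral_of_dominated_loc_of_deriv_le (s := Ioo 0 (τ + 1))
    (bound := fun r ↦ (2 + p) * Real.exp K * ((K * (1 + r)) ^ (N + 2) * Real.exp (-r)))
    (Ioo_mem_nhds hτ (by linarith))
    (.of_forall fun τ ↦ Measurable.aestronglyMeasurable (by fun_prop))
    ((integrableOn_exp_mul_cpow_ray (mul_pos hτ hc) (mul_pos hτ hv) p).mul_const _)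
    (Measurable.aestronglyMeasurable (by unfold rayIntegrandDeriv; fun_prop))
    ?_ ((integrableOn_mul_pow_mul_exp_neg _ _).const_mul _) ?_).2
  · filter_upwards [ae_restrict_mem measurableSet_Ioi] with r hr x hx
    have : x * (c + v) ≤ (τ + 1) * (c + v) := by gcongr; exact hx.2.le
    exact norm_rayIntegrandDeriv_le hc.le hv.le hx.1.le (by linarith) (by nlinarith) hp hN
      (le_of_lt hr)
  · filter_upwards [ae_restrict_mem measurableSet_Ioi] with r hr x hx
    exact hasDerivAt_rayIntegrand hc hv p hx.1 (le_of_lt hr)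

lemma rayIntegral_mul_im_eq {c v p τ : ℝ} (hc : 0 < c) (hv : 0 < v) (hτ : 0 < τ) (hp : 1 ≤ p) :
    (rayIntegral (τ * c) (τ * v) p).im = (rayIntegral c v p).im := by
  have hd (t : ℝ) (ht : t ∈ Ioi (0 : ℝ)) :
      HasDerivAt (fun τ : ℝ ↦ (rayIntegral (τ * c) (τ * v) p).im) 0 t := by
    have := Complex.imCLM.hasFDerivAt.comp_hasDerivAt t (hasDerivAt_rayIntegral_mul hc hv ht hp)
    rw [← integral_rayIntegrandDeriv_im hc hv ht hp]
    exact this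
  have := isOpen_Ioi.is_const_of_deriv_eq_zero isPreconnected_Ioi
    (fun t ht ↦ (hd t ht).differentiableAt.differentiableWithinAt)
    (fun t ht ↦ (hd t ht).deriv) (mem_Ioi.2 hτ) (mem_Ioi.2 one_pos)
  simpa using this

lemma tendsto_ray_mul_cpow {c v : ℝ} (hv : 0 < v) (p : ℂ) {r : ℝ} (hr : 0 < r) :
    Tendsto (fun τ : ℝ ↦ ray (τ * c) (τ * v) r ^ p) (𝓝[>] 0) (𝓝 ((-r : ℂ) ^ p)) := by
  have h0 : ray (0 * c) (0 * v) r = -r := by simp [ray]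
  have ht : Tendsto (fun τ : ℝ ↦ ray (τ * c) (τ * v) r) (𝓝[>] 0)
      (𝓝[{z : ℂ | 0 ≤ z.im}] (-r : ℂ)) := by
    refine tendsto_nhdsWithin_iff.2 ⟨?_, ?_⟩
    · have := (hasDerivAt_ray_mul c v r 0).continuousAt.tendsto
      rw [h0] at this
      exact this.mono_left nhdsWithin_le_nhds
    · filter_upwards [self_mem_nhdsWithin] with τ hτ
      have : 0 < τ := hτ
      change 0 ≤ (ray (τ * c) (τ * v) r).im
      rw [ray_im]
      positivity
  have hlog := Complex.continuousWithinAt_log_of_re_neg_of_im_zero (z := (-r : ℂ)) (by simpa)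
    (by simp)
  have hne : (-r : ℂ) ≠ 0 := by simpa using hr.ne'
  have hexp : Tendsto (fun τ : ℝ ↦ Complex.exp (Complex.log (ray (τ * c) (τ * v) r) * p)) (𝓝[>] 0)
      (𝓝 (Complex.exp (Complex.log (-r) * p))) :=
    (Complex.continuous_exp.tendsto _).comp ((hlog.tendsto.comp ht).mul_const p)
  rw [Complex.cpow_def_of_ne_zero hne]
  refine hexp.congr' ?_
  filter_upwards [self_mem_nhdsWithin] with τ hτ
  have hτ' : 0 < τ := hτ
  refine (Complex.cpow_def_of_ne_zero (fun h ↦ ?_) _).symm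
  have := congrArg Complex.im h
  rw [ray_im, Complex.zero_im] at this
  exact absurd this (by positivity)

lemma tendsto_rayIntegral_mul {c v p : ℝ} (hc : 0 < c) (hv : 0 < v) (hp : 0 ≤ p) :
    Tendsto (fun τ : ℝ ↦ rayIntegral (τ * c) (τ * v) p) (𝓝[>] 0)
      (𝓝 (∫ r in Ioi (0 : ℝ), Complex.exp (-r) * (-r : ℂ) ^ (p : ℂ) * (-1))) := by
  obtain ⟨N, hN⟩ := exists_nat_ge p
  set K := c + v + 1 with hK
  refine tendsto_integral_filter_of_dominated_convergence
    (fun r ↦ Real.exp K * ((K * (1 + r)) ^ N * Real.exp (-r)) * (1 + v))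
    (.of_forall fun p ↦ Measurable.aestronglyMeasurable (by fun_prop)) ?_
    (((integrableOn_mul_pow_mul_exp_neg K N).const_mul _).mul_const _) ?_
  · filter_upwards [Ioo_mem_nhdsGT one_pos] with τ hτ
    filter_upwards [ae_restrict_mem measurableSet_Ioi] with r hr
    rw [norm_mul]
    have h1 : τ * (c + v) ≤ 1 * (c + v) := by gcongr; exact hτ.2.le
    have hr' : 0 ≤ r := le_of_lt hr
    refine mul_le_mul (norm_exp_mul_cpow_ray_mul_le hc.le hv.le hτ.1.le (by linarith) hp hN hr')
      ?_ (norm_nonneg _) (by positivity)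
    refine (norm_add_le _ _).trans ?_
    have hτv : 0 ≤ τ * v := mul_nonneg hτ.1.le hv.le
    simp only [norm_mul, norm_neg, norm_one, Complex.norm_real, Complex.norm_I, Real.norm_eq_abs,
      abs_of_pos hτ.1, abs_of_pos hv, mul_one]
    nlinarith [hτ.2]
  · filter_upwards [ae_restrict_mem measurableSet_Ioi] with r hr
    have h0 : ray (0 * c) (0 * v) r = -r := by simp [ray]
    have h1 := (hasDerivAt_ray_mul c v r 0).continuousAt.tendsto
    rw [h0] at h1
    have h2 := (Complex.continuous_exp.tendsto _).comp (h1.mono_left (nhdsWithin_le_nhds (s := Ioi 0)))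
    refine (h2.mul (tendsto_ray_mul_cpow hv p hr)).mul ?_
    have : Continuous fun τ : ℝ ↦ (-1 + (τ * v : ℝ) * Complex.I : ℂ) := by fun_prop
    simpa using (this.tendsto 0).mono_left nhdsWithin_le_nhds

lemma integral_exp_neg_mul_neg_cpow_im {p : ℝ} (hp : -1 < p) :
    (∫ r in Ioi (0 : ℝ), Complex.exp (-r) * (-r : ℂ) ^ (p : ℂ) * (-1)).im =
      -(Real.sin (π * p) * Real.Gamma (p + 1)) := by
  have h : ∀ r ∈ Ioi (0 : ℝ), Complex.exp (-r) * (-r : ℂ) ^ (p : ℂ) * (-1) =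
      ((Real.exp (-r) * r ^ (p + 1 - 1) : ℝ) : ℂ) * (-Complex.exp ((π * p : ℝ) * Complex.I)) := by
    intro r hr
    have hr' : 0 < r := hr
    have := Complex.ofReal_cpow_of_nonpos (x := -r) (by linarith) p
    push_cast at this
    rw [this, neg_neg, add_sub_cancel_right]
    push_cast [Complex.ofReal_cpow hr'.le]
    ring_nf
  rw [setIntegral_congr_fun measurableSet_Ioi h, integral_mul_const, integral_complex_ofReal,
    ← Real.Gamma_eq_integral (by linarith), Complex.im_ofReal_mul, Complex.neg_im,
    Complex.exp_ofReal_mul_I_im]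
  ring

lemma rayIntegral_im_of_one_le {c v p : ℝ} (hc : 0 < c) (hv : 0 < v) (hp : 1 ≤ p) :
    (rayIntegral c v p).im = -(Real.sin (π * p) * Real.Gamma (p + 1)) := by
  have h1 := (Complex.continuous_im.tendsto _).comp
    (tendsto_rayIntegral_mul hc hv (by linarith : 0 ≤ p))
  rw [integral_exp_neg_mul_neg_cpow_im (by linarith)] at h1
  refine tendsto_nhds_unique (tendsto_const_nhds.congr' ?_) h1
  filter_upwards [self_mem_nhdsWithin] with τ hτ
  exact (rayIntegral_mul_im_eq hc hv hτ hp).symm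

lemma inv_Gamma_eq_mul (s : ℝ) : (Real.Gamma s)⁻¹ = s * (Real.Gamma (s + 1))⁻¹ := by
  have := Complex.one_div_Gamma_eq_self_mul_one_div_Gamma_add_one (s : ℂ)
  rw [← Complex.ofReal_one, ← Complex.ofReal_add, Complex.Gamma_ofReal, Complex.Gamma_ofReal] at this
  exact_mod_cast this

lemma continuous_inv_Gamma : Continuous fun s : ℝ ↦ (Real.Gamma s)⁻¹ := by
  have h : (fun s : ℝ ↦ (Real.Gamma s)⁻¹) = fun s : ℝ ↦ ((Complex.Gamma s)⁻¹).re := by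
    ext s; rw [Complex.Gamma_ofReal, ← Complex.ofReal_inv, Complex.ofReal_re]
  rw [h]
  exact Complex.continuous_re.comp
    (Complex.differentiable_one_div_Gamma.continuous.comp Complex.continuous_ofReal)

lemma pi_mul_inv_Gamma_neg {p : ℝ} (hp : -1 < p) :
    π * (Real.Gamma (-p))⁻¹ = -(Real.sin (π * p) * Real.Gamma (p + 1)) := by
  have h := Real.Gamma_mul_Gamma_one_sub (-p)
  rw [sub_neg_eq_add, add_comm 1 p, mul_neg, Real.sin_neg] at h
  have hG : Real.Gamma (p + 1) ≠ 0 := (Real.Gamma_pos_of_pos (by linarith)).ne'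
  by_cases hs : Real.sin (π * p) = 0
  · rw [hs, neg_zero, div_zero] at h
    simp [(mul_eq_zero.1 h).resolve_right hG, hs]
  · have : Real.Gamma (-p) ≠ 0 := by
      intro h0
      rw [h0, zero_mul] at h
      exact div_ne_zero Real.pi_ne_zero (neg_ne_zero.2 hs) h.symm
    rw [div_neg, ← neg_div, eq_div_iff hs] at h
    rw [← div_eq_mul_inv, div_eq_iff this]
    linear_combination h

/-- Hankel's integral representation of the reciprocal Gamma function. -/
theorem rayIntegral_im {c v : ℝ} (hc : 0 < c) (hv : 0 < v) (p : ℝ) :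
    (rayIntegral c v p).im = π * (Real.Gamma (-p))⁻¹ := by
  have hcont : Continuous fun p ↦ (rayIntegral c v p).im - π * (Real.Gamma (-p))⁻¹ :=
    (Complex.continuous_im.comp (continuous_rayIntegral hc hv)).sub
      ((continuous_inv_Gamma.comp continuous_neg).const_mul π)
  have hrec (p : ℝ) : (rayIntegral c v (p + 1)).im - π * (Real.Gamma (-(p + 1)))⁻¹ =
      -(p + 1) * ((rayIntegral c v p).im - π * (Real.Gamma (-p))⁻¹) := by
    rw [rayIntegral_im_eq hc hv (p + 1), inv_Gamma_eq_mul (-(p + 1)), add_sub_cancel_right,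
      show -(p + 1) + 1 = -p by ring]
    ring
  have key (n : ℕ) :
      ∀ p : ℝ, 1 - n < p → (rayIntegral c v p).im - π * (Real.Gamma (-p))⁻¹ = 0 := by
    induction n with
    | zero =>
      intro p hp
      have hp' : 1 < p := by simpa using hp
      rw [rayIntegral_im_of_one_le hc hv hp'.le, pi_mul_inv_Gamma_neg (by linarith), sub_self]
    | succ n ih =>
      intro p hp
      push_cast at hp
      have hne (q : ℝ) (hq : p ≤ q) (hq' : q ≠ -1) :
          (rayIntegral c v q).im - π * (Real.Gamma (-q))⁻¹ = 0 := by
        have := hrec q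
        rw [ih (q + 1) (by linarith)] at this
        refine (mul_eq_zero.1 this.symm).resolve_left fun h ↦ hq' (by linarith)
      by_cases hp1 : p = -1
      · refine tendsto_nhds_unique ((hcont.tendsto p).mono_left nhdsWithin_le_nhds)
          (tendsto_const_nhds.congr' (f₁ := fun _ ↦ (0 : ℝ)) (l₁ := 𝓝[>] p) ?_)
        filter_upwards [self_mem_nhdsWithin] with q hq
        have hq' : p < q := hq
        exact (hne q hq'.le (by linarith)).symm
      · exact hne p le_rfl hp1
  obtain ⟨n, hn⟩ := exists_nat_gt (1 - p)
  exact sub_eq_zero.1 (key n p (by linarith))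

lemma arg_ray_le {c r θ : ℝ} (hc : 0 < c) (hθ : π / 2 < θ) (hθ' : θ < π) :
    Complex.arg (ray c (-Real.tan θ) r) ≤ θ := by
  by_contra! h
  set ζ := ray c (-Real.tan θ) r with hζ
  have hcos : Real.cos θ < 0 :=
    Real.cos_neg_of_pi_div_two_lt_of_lt hθ (by linarith [Real.pi_pos])
  have hsin : 0 < Real.sin θ := Real.sin_pos_of_pos_of_lt_pi (by linarith [Real.pi_pos]) hθ'
  have h1 : 0 < Real.sin (Complex.arg ζ - θ) :=
    Real.sin_pos_of_pos_of_lt_pi (by linarith) (by linarith [Complex.arg_le_pi ζ, Real.pi_pos])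
  have h2 : ‖ζ‖ * Real.sin (Complex.arg ζ - θ) = -(c * Real.sin θ) := by
    rw [Real.sin_sub, mul_sub, ← mul_assoc, ← mul_assoc, Complex.norm_mul_sin_arg,
      Complex.norm_mul_cos_arg, hζ, ray_re, ray_im, Real.tan_eq_sin_div_cos]
    have := hcos.ne
    field_simp
    ring
  have h3 : 0 ≤ ‖ζ‖ * Real.sin (Complex.arg ζ - θ) := by positivity
  have : 0 < c * Real.sin θ := by positivity
  linarith

lemma exists_le_re_ray_cpow {α : ℝ} (hα0 : 0 < α) (hα1 : α < 1) (M : ℝ) :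
    ∃ c v : ℝ, 0 < c ∧ 0 < v ∧ ∀ r : ℝ, 0 ≤ r → M ≤ (ray c v r ^ (α : ℂ)).re := by
  have hpi := Real.pi_pos
  set θ := π / (1 + α) with hθ
  have hθ1 : π / 2 < θ := by rw [hθ]; gcongr; linarith
  have hθ2 : θ < π := by rw [hθ, div_lt_iff₀ (by linarith)]; nlinarith
  have hθ3 : θ * α < π / 2 := by
    rw [hθ, div_mul_eq_mul_div, div_lt_iff₀ (by linarith)]; nlinarith
  set v := -Real.tan θ with hv
  have hv0 : 0 < v := by
    have hcos : Real.cos θ < 0 := Real.cos_neg_of_pi_div_two_lt_of_lt hθ1 (by linarith)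
    have hsin : 0 < Real.sin θ := Real.sin_pos_of_pos_of_lt_pi (by linarith) hθ2
    rw [hv, Real.tan_eq_sin_div_cos, neg_pos]
    exact div_neg_of_pos_of_neg hsin hcos
  have hm0 : 0 < min 1 v / 2 := by have : 0 < min 1 v := lt_min one_pos hv0
                                   positivity
  have hk : 0 < Real.cos (θ * α) :=
    Real.cos_pos_of_mem_Ioo ⟨by have : 0 < θ * α := by positivity
                                linarith, hθ3⟩
  have hlim : Tendsto (fun c : ℝ ↦ (c * (min 1 v / 2)) ^ α * Real.cos (θ * α)) atTop atTop :=
    ((tendsto_rpow_atTop hα0).comp (tendsto_id.atTop_mul_const hm0)).atTop_mul_const hk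
  obtain ⟨c, hcM, hc⟩ := ((hlim.eventually_ge_atTop M).and (eventually_gt_atTop 0)).exists
  refine ⟨c, v, hc, hv0, fun r hr ↦ hcM.trans ?_⟩
  rw [Complex.cpow_ofReal_re]
  have harg : Complex.arg (ray c v r) ≤ θ := arg_ray_le hc hθ1 hθ2
  have harg0 : 0 ≤ Complex.arg (ray c v r) := by
    rw [Complex.arg_nonneg_iff, ray_im]; positivity
  have h1 := le_norm_ray (r := r) hc.le hv0.le
  have h2 : Real.cos (θ * α) ≤ Real.cos (Complex.arg (ray c v r) * α) :=
    Real.cos_le_cos_of_nonneg_of_le_pi (by positivity) (by linarith) (by gcongr)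
  rw [mul_div_assoc] at h1
  gcongr

lemma exists_mul_rpow_le {α t ε : ℝ} (hα0 : 0 ≤ α) (hα1 : α < 1) (ht : 0 ≤ t) (hε : 0 < ε) :
    ∃ B : ℝ, ∀ x : ℝ, 0 ≤ x → t * x ^ α ≤ ε * x + B := by
  have hlim : Tendsto (fun M : ℝ ↦ t * M ^ (-(1 - α))) atTop (𝓝 (t * 0)) :=
    (tendsto_rpow_neg_atTop (by linarith)).const_mul t
  rw [mul_zero] at hlim
  obtain ⟨M, hM, hM0⟩ := ((hlim.eventually_le_const hε).and (eventually_gt_atTop 0)).exists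
  refine ⟨t * M ^ α, fun x hx ↦ ?_⟩
  rcases le_total x M with h | h
  · have : t * x ^ α ≤ t * M ^ α := by gcongr
    nlinarith
  · have hx0 : 0 < x := hM0.trans_le h
    have h1 : x ^ (-(1 - α)) ≤ M ^ (-(1 - α)) :=
      Real.rpow_le_rpow_of_nonpos hM0 h (by linarith)
    have h2 : x ^ α = x ^ (-(1 - α)) * x := by
      rw [← Real.rpow_add_one hx0.ne']; ring_nf
    have h3 : t * x ^ (-(1 - α)) ≤ ε := (mul_le_mul_of_nonneg_left h1 ht).trans hM
    have h4 : 0 ≤ t * M ^ α := by positivity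
    rw [h2, ← mul_assoc]
    nlinarith

lemma integrableOn_norm_mul_exp_rpow_ray {c v α t : ℝ} (hc : 0 < c) (hv : 0 < v) (hα0 : 0 ≤ α)
    (hα1 : α < 1) (ht : 0 ≤ t) (p : ℝ) :
    IntegrableOn (fun r ↦ ‖Complex.exp (ray c v r) * ray c v r ^ (p : ℂ)‖ *
      Real.exp (t * ‖ray c v r‖ ^ α)) (Ioi 0) := by
  obtain ⟨N, hN⟩ := exists_nat_ge |p|
  obtain ⟨C, hC0, hC⟩ := exists_norm_exp_mul_cpow_ray_le hc hv N
  set K := 1 + c + v with hK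
  have hK0 : 0 < K := by positivity
  obtain ⟨B, hB⟩ := exists_mul_rpow_le hα0 hα1 ht (ε := 1 / (4 * K)) (by positivity)
  refine Integrable.mono' ((integrableOn_exp_mul_Ioi (a := -1 / 4) (by norm_num) 0).const_mul
    (C * Real.exp (1 / 4 + B))) (Measurable.aestronglyMeasurable (by fun_prop)) ?_
  filter_upwards [ae_restrict_mem measurableSet_Ioi] with r hr
  have hr' : 0 ≤ r := le_of_lt hr
  rw [Real.norm_of_nonneg (by positivity)]
  have h1 : t * ‖ray c v r‖ ^ α ≤ (1 + r) / 4 + B := by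
    refine (hB _ (norm_nonneg _)).trans ?_
    have : 1 / (4 * K) * ‖ray c v r‖ ≤ 1 / (4 * K) * (K * (1 + r)) := by
      gcongr; exact norm_ray_le hc.le hv.le hr'
    have e : 1 / (4 * K) * (K * (1 + r)) = (1 + r) / 4 := by field_simp
    linarith
  calc _ ≤ C * Real.exp (-r / 2) * Real.exp ((1 + r) / 4 + B) := by
        gcongr; exact hC p hN r hr'
    _ = _ := by
        rw [mul_assoc, mul_assoc, ← Real.exp_add, ← Real.exp_add]; ring_nf

/-- The contour integral representation of the Wright function. -/
lemma wrightFn_eq_integral {c v α t : ℝ} (hc : 0 < c) (hv : 0 < v) (hα0 : 0 ≤ α) (hα1 : α < 1)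
    (ht : 0 ≤ t) :
    wrightFn α t = π⁻¹ * (∫ r in Ioi (0 : ℝ), Complex.exp (ray c v r) *
      ray c v r ^ ((α - 1 : ℝ) : ℂ) * (-1 + v * Complex.I) *
        Complex.exp (-t * ray c v r ^ (α : ℂ))).im := by
  have key := hasSum_integral_of_dominated_convergence (μ := volume.restrict (Ioi (0 : ℝ)))
    (F := fun (n : ℕ) r ↦ Complex.exp (ray c v r) * ray c v r ^ ((α * n + α - 1 : ℝ) : ℂ) *
      (-1 + v * Complex.I) * (((-t) ^ n / n.factorial : ℝ) : ℂ))
    (f := fun r ↦ Complex.exp (ray c v r) * ray c v r ^ ((α - 1 : ℝ) : ℂ) * (-1 + v * Complex.I) *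
        Complex.exp (-t * ray c v r ^ (α : ℂ)))
    (fun n r ↦ ‖Complex.exp (ray c v r) * ray c v r ^ ((α - 1 : ℝ) : ℂ)‖ *
      ‖(-1 + v * Complex.I : ℂ)‖ * ((t * ‖ray c v r‖ ^ α) ^ n / n.factorial))
    (fun n ↦ Measurable.aestronglyMeasurable (by fun_prop)) ?_ ?_ ?_ ?_
  · have h := (Complex.hasSum_im key).mul_left π⁻¹
    rw [← h.tsum_eq, wrightFn]
    congr 1
    ext n
    rw [integral_mul_const]
    change _ = π⁻¹ * (rayIntegral c v (α * n + α - 1) * _).im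
    rw [Complex.im_mul_ofReal, rayIntegral_im hc hv,
      show -(α * n + α - 1) = -α * n + 1 - α by ring, ← mul_assoc,
      inv_mul_cancel_left₀ Real.pi_ne_zero, div_mul_eq_div_div, div_eq_mul_inv _ (Real.Gamma _),
      mul_comm]
  all_goals
    have hsplit (n : ℕ) (r : ℝ) (hr : r ∈ Ioi (0 : ℝ)) :
        ray c v r ^ ((α * n + α - 1 : ℝ) : ℂ) =
          ray c v r ^ ((α - 1 : ℝ) : ℂ) * (ray c v r ^ (α : ℂ)) ^ n := by
      rw [← Complex.cpow_mul_nat, ← Complex.cpow_add _ _ (ray_ne_zero hc hv (le_of_lt hr))]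
      push_cast; ring_nf
  · intro n
    filter_upwards [ae_restrict_mem measurableSet_Ioi] with r hr
    rw [hsplit n r hr]
    simp only [norm_mul, norm_pow, Complex.norm_cpow_real, Complex.norm_real, norm_div, norm_neg,
      Real.norm_of_nonneg ht, Real.norm_natCast]
    apply le_of_eq; ring
  · refine .of_forall fun r ↦ (Real.summable_pow_div_factorial _).mul_left _
  · refine ((integrableOn_norm_mul_exp_rpow_ray hc hv hα0 hα1 ht (α - 1)).mul_const
      ‖(-1 + v * Complex.I : ℂ)‖).congr (.of_forall fun r ↦ ?_)
    simp only [tsum_mul_left, Real.exp_eq_exp_ℝ, NormedSpace.exp_eq_tsum_div]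
    ring
  · filter_upwards [ae_restrict_mem measurableSet_Ioi] with r hr
    have h := (NormedSpace.expSeries_div_hasSum_exp (-t * ray c v r ^ (α : ℂ))).mul_left
      (Complex.exp (ray c v r) * ray c v r ^ ((α - 1 : ℝ) : ℂ) * (-1 + v * Complex.I))
    rw [← Complex.exp_eq_exp_ℂ] at h
    refine h.congr_fun fun n ↦ ?_
    rw [hsplit n r hr]
    push_cast; ring

/-- The contour integral representation of the Mittag-Leffler function. -/
lemma mittagLeffler_eq_integral {c v α z : ℝ} (hc : 0 < c) (hv : 0 < v)
    (hz : ∀ r : ℝ, 0 ≤ r → |z| + 1 ≤ (ray c v r ^ (α : ℂ)).re) :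
    mittagLeffler α z = π⁻¹ * (∫ r in Ioi (0 : ℝ), Complex.exp (ray c v r) *
      ray c v r ^ ((α - 1 : ℝ) : ℂ) * (-1 + v * Complex.I) *
        (ray c v r ^ (α : ℂ) - z)⁻¹).im := by
  set q := |z| / (|z| + 1) with hq
  have hz0 : 0 < |z| + 1 := by positivity
  have hq1 : q < 1 := by rw [hq, div_lt_one hz0]; linarith
  have hgeom := summable_geometric_of_lt_one (by positivity) hq1
  have hnorm (r : ℝ) (hr : 0 ≤ r) : |z| + 1 ≤ ‖ray c v r ^ (α : ℂ)‖ :=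
    (hz r hr).trans (Complex.re_le_norm _)
  have hsplit (k : ℕ) (r : ℝ) (hr : 0 ≤ r) :
      ray c v r ^ ((-(α * k) - 1 : ℝ) : ℂ) * (z ^ k : ℝ) =
        ray c v r ^ ((α - 1 : ℝ) : ℂ) * (ray c v r ^ (α : ℂ))⁻¹ *
          (z * (ray c v r ^ (α : ℂ))⁻¹) ^ k := by
    have h0 := ray_ne_zero hc hv hr
    rw [mul_pow, inv_pow, ← Complex.cpow_mul_nat, ← Complex.cpow_neg, ← Complex.cpow_neg,
      ← Complex.cpow_add _ _ h0, mul_left_comm, ← Complex.cpow_add _ _ h0, mul_comm]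
    push_cast; ring_nf
  have hratio (r : ℝ) (hr : 0 ≤ r) : ‖z * (ray c v r ^ (α : ℂ))⁻¹‖ ≤ q := by
    rw [norm_mul, norm_inv, Complex.norm_real, Real.norm_eq_abs, hq, div_eq_mul_inv]
    gcongr
    exact hnorm r hr
  have key := hasSum_integral_of_dominated_convergence (μ := volume.restrict (Ioi (0 : ℝ)))
    (F := fun (k : ℕ) r ↦ Complex.exp (ray c v r) * ray c v r ^ ((-(α * k) - 1 : ℝ) : ℂ) *
      (-1 + v * Complex.I) * ((z ^ k : ℝ) : ℂ))
    (f := fun r ↦ Complex.exp (ray c v r) * ray c v r ^ ((α - 1 : ℝ) : ℂ) * (-1 + v * Complex.I) *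
      (ray c v r ^ (α : ℂ) - z)⁻¹)
    (fun k r ↦ ‖Complex.exp (ray c v r) * ray c v r ^ ((α - 1 : ℝ) : ℂ)‖ *
      ‖(-1 + v * Complex.I : ℂ)‖ * q ^ k)
    (fun n ↦ Measurable.aestronglyMeasurable (by fun_prop)) ?_ ?_ ?_ ?_
  · have h := (Complex.hasSum_im key).mul_left π⁻¹
    rw [← h.tsum_eq, mittagLeffler]
    congr 1
    ext k
    rw [integral_mul_const]
    change _ = π⁻¹ * (rayIntegral c v (-(α * k) - 1) * _).im
    rw [Complex.im_mul_ofReal, rayIntegral_im hc hv,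
      show -(-(α * k) - 1) = α * k + 1 by ring, ← mul_assoc,
      inv_mul_cancel_left₀ Real.pi_ne_zero, div_eq_mul_inv, mul_comm]
  · intro k
    filter_upwards [ae_restrict_mem measurableSet_Ioi] with r hr
    have hr' : 0 ≤ r := le_of_lt hr
    rw [mul_right_comm, mul_assoc (Complex.exp _), hsplit k r hr', mul_assoc (_ ^ _), ← mul_assoc,
      norm_mul, norm_mul (Complex.exp _ * _), mul_right_comm]
    gcongr
    rw [norm_mul, norm_pow, norm_inv]
    have h1 : ‖ray c v r ^ (α : ℂ)‖⁻¹ ≤ 1 :=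
      inv_le_one_of_one_le₀ (by linarith [hnorm r hr', abs_nonneg z])
    calc _ ≤ 1 * q ^ k := by
          gcongr
          exact hratio r hr'
      _ = _ := one_mul _
  · exact .of_forall fun r ↦ hgeom.mul_left _
  · simp only [tsum_mul_left]
    exact ((integrableOn_exp_mul_cpow_ray hc hv (α - 1)).norm.mul_const _).mul_const _
  · filter_upwards [ae_restrict_mem measurableSet_Ioi] with r hr
    have hr' : 0 ≤ r := le_of_lt hr
    have hne : ray c v r ^ (α : ℂ) ≠ 0 := by
      rw [← norm_pos_iff]; exact hz0.trans_le (hnorm r hr')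
    have h := (hasSum_geometric_of_norm_lt_one ((hratio r hr').trans_lt hq1)).mul_left
      (Complex.exp (ray c v r) * (ray c v r ^ ((α - 1 : ℝ) : ℂ) * (ray c v r ^ (α : ℂ))⁻¹) *
        (-1 + v * Complex.I))
    have hinv : (1 - z * (ray c v r ^ (α : ℂ))⁻¹)⁻¹ =
        ray c v r ^ (α : ℂ) * (ray c v r ^ (α : ℂ) - z)⁻¹ := by
      rw [← mul_inv_cancel₀ hne, ← sub_mul, mul_inv, inv_inv, mul_comm]
    have hsum : Complex.exp (ray c v r) *
        (ray c v r ^ ((α - 1 : ℝ) : ℂ) * (ray c v r ^ (α : ℂ))⁻¹) * (-1 + v * Complex.I) *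
          (1 - z * (ray c v r ^ (α : ℂ))⁻¹)⁻¹ =
        Complex.exp (ray c v r) * ray c v r ^ ((α - 1 : ℝ) : ℂ) * (-1 + v * Complex.I) *
          (ray c v r ^ (α : ℂ) - z)⁻¹ := by
      rw [hinv, ← mul_assoc, ← mul_assoc]
      congr 1
      field_simp
    rw [hsum] at h
    refine h.congr_fun fun k ↦ ?_
    rw [mul_right_comm, mul_assoc (Complex.exp _), hsplit k r hr']
    ring

/-- For `0 < α < 1` and `z ∈ ℝ`, `E_α(z) = ∫₀^∞ Φ_α(t) e^{zt} dt`. -/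
theorem mittagLeffler_eq_integral_wright (α : ℝ) (hα0 : 0 < α) (hα1 : α < 1) (z : ℝ) :
    mittagLeffler α z = ∫ t in Set.Ioi (0 : ℝ), wrightFn α t * Real.exp (z * t) := by
  obtain ⟨c, v, hc, hv, hz⟩ := exists_le_re_ray_cpow hα0 hα1 (|z| + 1)
  set g : ℝ → ℂ := fun r ↦ Complex.exp (ray c v r) * ray c v r ^ ((α - 1 : ℝ) : ℂ) *
    (-1 + v * Complex.I) with hg
  have hgi : IntegrableOn g (Ioi 0) := (integrableOn_exp_mul_cpow_ray hc hv (α - 1)).mul_const _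
  have hre (r : ℝ) (hr : 0 ≤ r) : (z - ray c v r ^ (α : ℂ)).re ≤ -1 := by
    rw [Complex.sub_re, Complex.ofReal_re]
    linarith [hz r hr, le_abs_self z]
  have hint : Integrable (Function.uncurry fun t r : ℝ ↦
      g r * Complex.exp ((z - ray c v r ^ (α : ℂ)) * t))
      ((volume.restrict (Ioi 0)).prod (volume.restrict (Ioi 0))) := by
    refine Integrable.mono' ((integrableOn_exp_mul_Ioi (a := -1) (by norm_num) 0).mul_prod hgi.norm)
      (Measurable.aestronglyMeasurable (by simp only [hg]; fun_prop)) ?_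
    rw [Measure.prod_restrict]
    filter_upwards [ae_restrict_mem (measurableSet_Ioi.prod measurableSet_Ioi)] with ⟨t, r⟩ htr
    have ht : 0 < t := htr.1
    have hr : 0 < r := htr.2
    simp only [Function.uncurry]
    rw [norm_mul, mul_comm, Complex.norm_exp, Complex.re_mul_ofReal]
    gcongr
    exact hre r hr.le
  calc mittagLeffler α z
      = π⁻¹ * (∫ r in Ioi (0 : ℝ), g r * (ray c v r ^ (α : ℂ) - z)⁻¹).im :=
        mittagLeffler_eq_integral hc hv hz
    _ = π⁻¹ * (∫ r in Ioi (0 : ℝ), ∫ t in Ioi (0 : ℝ),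
          g r * Complex.exp ((z - ray c v r ^ (α : ℂ)) * t)).im := by
        congr 2
        refine setIntegral_congr_fun measurableSet_Ioi fun r hr ↦ ?_
        rw [integral_const_mul, integral_exp_mul_complex_Ioi (by linarith [hre r (le_of_lt hr)]),
          Complex.ofReal_zero, mul_zero, Complex.exp_zero, neg_div, ← div_neg, neg_sub, one_div]
    _ = π⁻¹ * (∫ t in Ioi (0 : ℝ), ∫ r in Ioi (0 : ℝ),
          g r * Complex.exp ((z - ray c v r ^ (α : ℂ)) * t)).im := by
        rw [integral_integral_swap hint]
    _ = ∫ t in Ioi (0 : ℝ), π⁻¹ * (∫ r in Ioi (0 : ℝ),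
          g r * Complex.exp ((z - ray c v r ^ (α : ℂ)) * t)).im := by
        rw [integral_const_mul]
        congr 1
        exact (Complex.imCLM.integral_comp_comm hint.integral_prod_left).symm
    _ = _ := by
        refine setIntegral_congr_fun measurableSet_Ioi fun t ht ↦ ?_
        rw [wrightFn_eq_integral hc hv hα0.le hα1 (le_of_lt ht), mul_assoc,
          ← Complex.im_mul_ofReal, ← integral_mul_const]
        congr 2
        refine integral_congr_ae (.of_forall fun r ↦ ?_)
        simp only [hg]
        rw [mul_assoc _ (Complex.exp (-t * _)), Complex.ofReal_exp, ← Complex.exp_add]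
        congr 2
        push_cast; ring
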